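/- If a state of PIF satisfies RQ(l,m) for some 0 ≤ l < m ≤ N, then at least one PIF action is enabled in that state. -/

import Mathlib

/-- Values of the state variable of a PIF process: idle, requesting, replying. -/
inductive PSt where
  | idle | rq | rp
deriving DecidableEq

/-- A PIF state on the chain of `N` processes is valid if the root (process 1)
never holds `rp` and the leaf (process `N`) never holds `rq`. -/
def PifValid (N : ℕ) (st : ℕ → PSt) : Prop := st 1 ≠ PSt.rp ∧ st N ≠ PSt.rq

/-- One step of the PIF program on the chain of `N` processes: `st'` is
obtained from `st` by executing one enabled action (request, clear, forward,
back, stop, reflect or reset). -/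
def pifStep (N : ℕ) (st st' : ℕ → PSt) : Prop :=
  -- request (root)
  (st 1 = PSt.idle ∧ st 2 = PSt.idle ∧ st' = Function.update st 1 PSt.rq) ∨
  -- clear (root)
  (st 1 = PSt.rq ∧ st 2 = PSt.rp ∧ st' = Function.update st 1 PSt.idle) ∨
  -- forward (intermediate)
  (∃ j, 2 ≤ j ∧ j ≤ N - 1 ∧ st (j - 1) = PSt.rq ∧ st j = PSt.idle ∧
    st (j + 1) = PSt.idle ∧ st' = Function.update st j PSt.rq) ∨
  -- back (intermediate)
  (∃ j, 2 ≤ j ∧ j ≤ N - 1 ∧ st (j - 1) = PSt.rq ∧ st j = PSt.rq ∧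
    st (j + 1) = PSt.rp ∧ st' = Function.update st j PSt.rp) ∨
  -- stop (intermediate)
  (∃ j, 2 ≤ j ∧ j ≤ N - 1 ∧ st (j - 1) = PSt.idle ∧ st j ≠ PSt.idle ∧
    st' = Function.update st j PSt.idle) ∨
  -- reflect (leaf)
  (st (N - 1) = PSt.rq ∧ st N = PSt.idle ∧ st' = Function.update st N PSt.rp) ∨
  -- reset (leaf)
  (st (N - 1) = PSt.idle ∧ st N = PSt.rp ∧ st' = Function.update st N PSt.idle)

/-- `RP N k st`: the `k` leftmost processes are requesting and the rest are
replying (`1 ≤ k ≤ N - 1`). -/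
def RP (N k : ℕ) (st : ℕ → PSt) : Prop :=
  1 ≤ k ∧ k ≤ N - 1 ∧
  (∀ j, 1 ≤ j → j ≤ k → st j = PSt.rq) ∧
  (∀ j, k < j → j ≤ N → st j = PSt.rp)

/-- `RQ N l m st`: the `l` leftmost processes are requesting, processes
`l+1 .. m` are idle, and the rest are replying (`0 ≤ l < m ≤ N`). -/
def RQ (N l m : ℕ) (st : ℕ → PSt) : Prop :=
  l < m ∧ m ≤ N ∧
  (∀ j, 1 ≤ j → j ≤ l → st j = PSt.rq) ∧
  (∀ j, l < j → j ≤ m → st j = PSt.idle) ∧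
  (∀ j, m < j → j ≤ N → st j = PSt.rp)

/-- `RP' N k st`: the `k` leftmost processes are requesting, process `k+1` is
replying, and no process beyond `k+1` is idle (`1 ≤ k ≤ N - 1`). -/
def RP' (N k : ℕ) (st : ℕ → PSt) : Prop :=
  1 ≤ k ∧ k ≤ N - 1 ∧
  (∀ j, 1 ≤ j → j ≤ k → st j = PSt.rq) ∧
  st (k + 1) = PSt.rp ∧
  (∀ j, k + 1 < j → j ≤ N → st j ≠ PSt.idle)

/-- `RQ' N l m st`: the `l` leftmost processes are requesting, processes
`l+1 .. m` are idle, and the remaining processes are arbitrary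
(`0 ≤ l < m ≤ N`). -/
def RQ' (N l m : ℕ) (st : ℕ → PSt) : Prop :=
  l < m ∧ m ≤ N ∧
  (∀ j, 1 ≤ j → j ≤ l → st j = PSt.rq) ∧
  (∀ j, l < j → j ≤ m → st j = PSt.idle)

/-- If a state of `PIF` satisfies `RQ l m`, then at least one action is
enabled in it. -/
theorem pif_rq_enabled (N : ℕ) (hN : 3 ≤ N)
    (st : ℕ → PSt) (hv : PifValid N st)
    (l m : ℕ) (h : RQ N l m st) :
    ∃ st', pifStep N st st' := by
  obtain ⟨hlm, hmN, hq, hi, hp⟩ := h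
  unfold pifStep
  by_cases hm : m < N
  · by_cases hm' : m + 1 = N
    · refine ⟨_, Or.inr (Or.inr (Or.inr (Or.inr (Or.inr (Or.inr ⟨?_, ?_, rfl⟩)))))⟩
      · exact hi _ (by omega) (by omega)
      · exact hp _ (by omega) (by omega)
    · refine ⟨_, Or.inr (Or.inr (Or.inr (Or.inr (Or.inl
        ⟨m + 1, by omega, by omega, ?_, ?_, rfl⟩))))⟩
      · exact hi _ (by omega) (by omega)
      · rw [hp (m + 1) (by omega) (by omega)]
        simp
  · by_cases hl : l = 0
    · exact ⟨_, Or.inl ⟨hi _ (by omega) (by omega), hi _ (by omega) (by omega), rfl⟩⟩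
    · by_cases hl' : l + 1 = N
      · refine ⟨_, Or.inr (Or.inr (Or.inr (Or.inr (Or.inr (Or.inl ⟨?_, ?_, rfl⟩)))))⟩
        · exact hq _ (by omega) (by omega)
        · exact hi _ (by omega) (by omega)
      · exact ⟨_, Or.inr (Or.inr (Or.inl ⟨l + 1, by omega, by omega,
          hq _ (by omega) (by omega), hi _ (by omega) (by omega),
          hi _ (by omega) (by omega), rfl⟩))⟩
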